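/- Let (Ω, P) be a probability space, let v* ∈ ℝ, ς, ϑ > 0 and t₀ ≤ t_f be reals. Let V, A : ℝ × Ω → ℝ be jointly measurable and suppose that for every t ∈ [t₀, t_f] the pushforward of P under ω ↦ (V(t, ω), A(t, ω)) equals the product measure (gaussianReal v* ς²) ⊗ (gaussianReal 0 ϑ²). Then ∫_Ω ∫_{t₀}^{t_f} V(t, ω) · max(A(t, ω), 0) dt dP(ω) = (t_f − t₀) · v* · ϑ / √(2π). -/

import Mathlib

open MeasureTheory ProbabilityTheory

lemma integral_max_gauss (ϑ : ℝ) (hϑ : 0 < ϑ) :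
    ∫ x, max x 0 ∂(gaussianReal 0 ((ϑ ^ 2).toNNReal)) = ϑ / Real.sqrt (2 * Real.pi) := by
  have h0 : (ϑ ^ 2).toNNReal ≠ 0 := by
    simp only [ne_eq, Real.toNNReal_eq_zero, not_le]; positivity
  have hc : ((ϑ ^ 2).toNNReal : ℝ) = ϑ ^ 2 := Real.coe_toNNReal _ (by positivity)
  rw [integral_gaussianReal_eq_integral_smul h0]
  have h1 : ∀ x : ℝ, gaussianPDFReal 0 ((ϑ ^ 2).toNNReal) x • max x 0 =
      (Set.Ioi (0:ℝ)).indicator (fun x => (Real.sqrt (2 * Real.pi * ϑ ^ 2))⁻¹ *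
        (x ^ (1:ℝ) * Real.exp (-(1 / (2 * ϑ ^ 2)) * x ^ (2:ℝ)))) x := by
    intro x
    by_cases hx : 0 < x
    · rw [Set.indicator_of_mem (Set.mem_Ioi.2 hx), gaussianPDFReal, hc, max_eq_left hx.le]
      simp only [sub_zero, smul_eq_mul, Real.rpow_one, Real.rpow_ofNat]
      have : -x ^ 2 / (2 * ϑ ^ 2) = -(1 / (2 * ϑ ^ 2)) * x ^ 2 := by ring
      rw [this]; ring
    · rw [Set.indicator_of_notMem (by simpa using hx), max_eq_right (not_lt.1 hx)]
      simp
  simp_rw [h1]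
  rw [integral_indicator measurableSet_Ioi, integral_const_mul,
    integral_rpow_mul_exp_neg_mul_rpow (by norm_num) (by norm_num) (by positivity)]
  have e1 : -((1:ℝ) + 1) / 2 = -1 := by norm_num
  have e2 : ((1:ℝ) + 1) / 2 = 1 := by norm_num
  rw [e1, e2, Real.Gamma_one, Real.rpow_neg_one, Real.sqrt_mul (by positivity),
    Real.sqrt_sq hϑ.le]
  field_simp

/-- Theorem 3 of the paper: if at each time `t ∈ [t₀, t_f]` the speed `V t ~ N(v*, ς²)`
and the acceleration `A t ~ N(0, ϑ²)` are independent (joint law is the product of the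
Gaussians), then the expected surrogate energy consumption equals
`(t_f − t₀) v* ϑ / √(2π)`. -/
theorem expected_energy_of_gaussian
    {Ω : Type*} [MeasurableSpace Ω] (P : Measure Ω) [IsProbabilityMeasure P]
    (vstar ς ϑ : ℝ) (hς : 0 < ς) (hϑ : 0 < ϑ)
    (t₀ tf : ℝ) (ht : t₀ ≤ tf)
    (V A : ℝ → Ω → ℝ)
    (hVmeas : Measurable (Function.uncurry V))
    (hAmeas : Measurable (Function.uncurry A))
    (hmap : ∀ t ∈ Set.Icc t₀ tf, P.map (fun ω => (V t ω, A t ω)) =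
      (gaussianReal vstar ((ς ^ 2).toNNReal)).prod (gaussianReal 0 ((ϑ ^ 2).toNNReal))) :
    ∫ ω, (∫ t in t₀..tf, V t ω * max (A t ω) 0) ∂P =
      (tf - t₀) * vstar * ϑ / Real.sqrt (2 * Real.pi) := by
  set μ := gaussianReal vstar ((ς ^ 2).toNNReal) with hμ
  set ν := gaussianReal 0 ((ϑ ^ 2).toNNReal) with hν
  have hi1 : Integrable (fun x : ℝ => x) μ :=
    (memLp_id_gaussianReal 1).integrable le_rfl
  have hi2' : Integrable (fun x : ℝ => x) ν :=
    (memLp_id_gaussianReal 1).integrable le_rfl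
  have hi2 : Integrable (fun x : ℝ => max x 0) ν := hi2'.pos_part
  have hi : Integrable (fun p : ℝ × ℝ => p.1 * max p.2 0) (μ.prod ν) := hi1.mul_prod hi2
  have hV : ∀ t, Measurable (V t) := fun t => hVmeas.comp measurable_prodMk_left
  have hA : ∀ t, Measurable (A t) := fun t => hAmeas.comp measurable_prodMk_left
  have hpair : ∀ t, Measurable (fun ω => (V t ω, A t ω)) := fun t => (hV t).prodMk (hA t)
  have hint : ∀ t ∈ Set.Icc t₀ tf, Integrable (fun ω => V t ω * max (A t ω) 0) P := by
    intro t h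
    have := hi
    rw [← hmap t h] at this
    exact this.comp_measurable (hpair t)
  have htr : ∀ t ∈ Set.Icc t₀ tf, ∀ f : ℝ × ℝ → ℝ, Measurable f →
      ∫ ω, f (V t ω, A t ω) ∂P = ∫ p, f p ∂(μ.prod ν) := by
    intro t h f hf
    rw [← hmap t h, integral_map (hpair t).aemeasurable hf.aestronglyMeasurable]
  have hm : Measurable (fun p : ℝ × ℝ => p.1 * max p.2 0) := by fun_prop
  have hval : ∀ t ∈ Set.Icc t₀ tf, ∫ ω, V t ω * max (A t ω) 0 ∂P =
      vstar * (ϑ / Real.sqrt (2 * Real.pi)) := by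
    intro t h
    rw [htr t h _ hm, integral_prod_mul (fun x : ℝ => x) (fun x : ℝ => max x 0),
      integral_id_gaussianReal, integral_max_gauss ϑ hϑ]
  have hunc : Measurable (Function.uncurry fun t ω => V t ω * max (A t ω) 0) :=
    hVmeas.mul (hAmeas.max measurable_const)
  have hfub : Integrable (Function.uncurry fun t ω => V t ω * max (A t ω) 0)
      ((volume.restrict (Set.uIoc t₀ tf)).prod P) := by
    rw [Set.uIoc_of_le ht, integrable_prod_iff hunc.aestronglyMeasurable]
    refine ⟨?_, ?_⟩
    · filter_upwards [ae_restrict_mem measurableSet_Ioc] with t h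
      exact hint t (Set.Ioc_subset_Icc_self h)
    · refine (integrable_const (∫ p, ‖p.1 * max p.2 0‖ ∂(μ.prod ν))).congr ?_
      filter_upwards [ae_restrict_mem measurableSet_Ioc] with t h
      exact (htr t (Set.Ioc_subset_Icc_self h) (fun p => ‖p.1 * max p.2 0‖) hm.norm).symm
  rw [← intervalIntegral_integral_swap hfub]
  rw [intervalIntegral.integral_congr (g := fun _ => vstar * (ϑ / Real.sqrt (2 * Real.pi)))]
  · simp only [intervalIntegral.integral_const, smul_eq_mul]; ring
  · intro t h
    rw [Set.uIcc_of_le ht] at h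
    exact hval t h
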